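/- There is a constant C = C(μ, δ, η) such that for every n ∈ ℤ∖{0} and every f ∈ 𝒞^δ_0: 𝒦_{n,1}f, 𝒦_{n,2}f, 𝒦_{n,3}f ∈ 𝒞^δ_0 and ‖𝒦_{n,1}f‖_{𝒞^δ} ≤ C|n|^{−1}‖f‖_{𝒞^δ}, ‖𝒦_{n,2}f‖_{𝒞^δ} ≤ C|n|^{−1}‖f‖_{𝒞^δ}, and ‖𝒦_{n,3}f‖_{𝒞^δ} ≤ C‖f‖_{𝒞^δ}. -/

import Mathlib

open Filter Topology Set MeasureTheory intervalIntegral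

/-- sup norm over `[0,∞)`. -/
noncomputable def supN (f : ℝ → ℂ) : ℝ := ⨆ β : Ici (0 : ℝ), ‖f (β : ℝ)‖

/-- weighted seminorm `sup_{β>0} β^δ ‖f(β) − L‖`. -/
noncomputable def hoel (δ : ℝ) (f : ℝ → ℂ) (L : ℂ) : ℝ :=
  ⨆ β : Ioi (0 : ℝ), (β : ℝ) ^ δ * ‖f (β : ℝ) - L‖

/-- the `𝒞^δ` norm, with `L = f(∞)`. -/
noncomputable def normC (δ : ℝ) (f : ℝ → ℂ) (L : ℂ) : ℝ := supN f + hoel δ f L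

/-- membership in `𝒞^δ`, with limit value `L` at infinity. -/
def MemCdelta (δ : ℝ) (f : ℝ → ℂ) (L : ℂ) : Prop :=
  ContinuousOn f (Ici 0) ∧ Tendsto f atTop (nhds L) ∧
    BddAbove (Set.range fun β : Ioi (0 : ℝ) => (β : ℝ) ^ δ * ‖f (β : ℝ) - L‖)

/-- `a_n(β) = √(n²μ² − (2μ−1)η(β))`. -/
noncomputable def aFun (μ : ℝ) (η : ℝ → ℝ) (n : ℤ) (β : ℝ) : ℝ :=
  Real.sqrt ((n : ℝ) ^ 2 * μ ^ 2 - (2 * μ - 1) * η β)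

/-- `χ_n(β) = η(β) − βη'(β)/(2a_n(β))`. -/
noncomputable def chiFun (μ : ℝ) (η : ℝ → ℝ) (n : ℤ) (β : ℝ) : ℝ :=
  η β - β * deriv η β / (2 * aFun μ η n β)

/-- `W_n(β) = exp(∫_1^β a_n(b)/b db)`. -/
noncomputable def WFun (μ : ℝ) (η : ℝ → ℝ) (n : ℤ) (β : ℝ) : ℝ :=
  Real.exp (∫ b in (1 : ℝ)..β, aFun μ η n b / b)

/-- `L_{n,-}^{-1}`. -/
noncomputable def Lminus (μ : ℝ) (η : ℝ → ℝ) (n : ℤ) (f : ℝ → ℂ) (β : ℝ) : ℂ :=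
  if 2 ≤ |n| then
    -(((β ^ (2 * μ - 1) / WFun μ η n β : ℝ) : ℂ) *
      ∫ b in (0 : ℝ)..β, ((b ^ (-(2 * μ)) * WFun μ η n b : ℝ) : ℂ) *
        Complex.exp (Complex.I * (n : ℂ) * ((β : ℂ) - (b : ℂ))) * f b)
  else
    ((β ^ (2 * μ - 1) / WFun μ η n β : ℝ) : ℂ) *
      ∫ b in Ioi β, ((b ^ (-(2 * μ)) * WFun μ η n b : ℝ) : ℂ) *
        Complex.exp (Complex.I * (n : ℂ) * ((β : ℂ) - (b : ℂ))) * f b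

/-- the averaging operator `(D_β+1)^{-1} f (β) = β^{-1} ∫_0^β f(b) db`. -/
noncomputable def Avg (f : ℝ → ℂ) (β : ℝ) : ℂ :=
  if β = 0 then f 0 else ((β⁻¹ : ℝ) : ℂ) * ∫ b in (0 : ℝ)..β, f b

/-- `T_n f (β) = in ∫_0^β L_{n,-}^{-1} f (b) db`. -/
noncomputable def Tn (μ : ℝ) (η : ℝ → ℝ) (n : ℤ) (f : ℝ → ℂ) (β : ℝ) : ℂ :=
  Complex.I * (n : ℂ) * ∫ b in (0 : ℝ)..β, Lminus μ η n f b

/-- `𝒦_{n,1} f = χ_n · (D_β+1)^{-1} L_{n,-}^{-1} f`. -/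
noncomputable def K1 (μ : ℝ) (η : ℝ → ℝ) (n : ℤ) (f : ℝ → ℂ) (β : ℝ) : ℂ :=
  ((chiFun μ η n β : ℝ) : ℂ) * Avg (Lminus μ η n f) β

/-- `𝒦_{n,2} f = (βχ_n') · (D_β+1)^{-1} L_{n,-}^{-1} f`. -/
noncomputable def K2 (μ : ℝ) (η : ℝ → ℝ) (n : ℤ) (f : ℝ → ℂ) (β : ℝ) : ℂ :=
  ((β * deriv (chiFun μ η n) β : ℝ) : ℂ) * Avg (Lminus μ η n f) β

/-- `𝒦_{n,3} f = (1−χ_n) · T_n f`. -/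
noncomputable def K3 (μ : ℝ) (η : ℝ → ℝ) (n : ℤ) (f : ℝ → ℂ) (β : ℝ) : ℂ :=
  ((1 - chiFun μ η n β : ℝ) : ℂ) * Tn μ η n f β

/-- Comparison with a monotone primitive on a left interval ending at the singular point `0`. -/
lemma integral_Ioc_le_of_deriv_ge {F F' G : ℝ → ℝ} {c : ℝ} (hc : 0 < c)
    (hF : ∀ x, 0 < x → 0 ≤ F x) (hd : ∀ x, 0 < x → HasDerivAt F (F' x) x)
    (hG : ContinuousOn G (Ioi 0)) (hG0 : ∀ x, 0 < x → 0 ≤ G x)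
    (hle : ∀ x, 0 < x → c * G x ≤ F' x) {β : ℝ} (hβ : 0 < β) :
    IntegrableOn G (Ioc 0 β) ∧ ∫ b in (0 : ℝ)..β, G b ≤ F β / c := by
  have key : ∀ ε, 0 < ε → ε ≤ β → ∫ b in ε..β, G b ≤ F β / c := by
    intro ε hε hεβ
    have h := intervalIntegral.integral_le_sub_of_hasDeriv_right_of_le (g := F) (g' := F')
      (φ := fun b => c * G b) hεβ
      (fun x hx => (hd x (hε.trans_le hx.1)).continuousAt.continuousWithinAt)
      (fun x hx => (hd x (hε.trans hx.1)).hasDerivWithinAt)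
      ((continuousOn_const.mul (hG.mono fun x hx => hε.trans_le hx.1)).integrableOn_Icc)
      (fun x hx => hle x (hε.trans hx.1))
    rw [intervalIntegral.integral_const_mul] at h
    rw [le_div_iff₀ hc]
    linarith [hF ε hε]
  have hε : ∀ i : ℕ, 0 < β / ((i : ℝ) + 1) := fun i => by positivity
  have hεβ : ∀ i : ℕ, β / ((i : ℝ) + 1) ≤ β := fun i =>
    div_le_self hβ.le (by linarith [(Nat.cast_nonneg i : (0 : ℝ) ≤ i)])
  have hlim : Tendsto (fun i : ℕ => β / ((i : ℝ) + 1)) atTop (𝓝 0) := by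
    have := (tendsto_one_div_add_atTop_nhds_zero_nat (𝕜 := ℝ)).const_mul β
    simpa [div_eq_mul_inv] using this
  have hint : IntegrableOn G (Ioc 0 β) := by
    refine integrableOn_Ioc_of_intervalIntegral_norm_bounded_left (I := F β / c)
      (fun i => ?_) hlim (Eventually.of_forall fun i => ?_)
    · exact ((hG.mono fun x hx => (hε i).trans_le hx.1).integrableOn_Icc).mono_set
        Ioc_subset_Icc_self
    · refine le_trans (le_of_eq ?_) (key _ (hε i) (hεβ i))
      rw [intervalIntegral.integral_of_le (hεβ i)]
      refine setIntegral_congr_fun measurableSet_Ioc fun x hx => ?_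
      exact Real.norm_of_nonneg (hG0 x ((hε i).trans hx.1))
  refine ⟨hint, ?_⟩
  have hI : IntervalIntegrable G volume 0 β :=
    (intervalIntegrable_iff_integrableOn_Ioc_of_le hβ.le).2 hint
  have hcont := intervalIntegral.continuousOn_primitive_interval' hI (a := β) (by simp)
  rw [uIcc_of_le hβ.le] at hcont
  have ht := (hcont 0 ⟨le_rfl, hβ.le⟩).tendsto.comp
    (tendsto_nhdsWithin_of_tendsto_nhds_of_eventually_within _ hlim
      (Eventually.of_forall fun i => ⟨(hε i).le, hεβ i⟩))
  have ht' := ht.neg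
  rw [← intervalIntegral.integral_symm] at ht'
  refine le_of_tendsto ht' (Eventually.of_forall fun i => ?_)
  simp only [Function.comp]
  rw [← intervalIntegral.integral_symm]
  exact key _ (hε i) (hεβ i)

/-- Comparison with a decreasing nonnegative primitive on a half-line. -/
lemma integral_Ioi_le_of_deriv_le {F F' G : ℝ → ℝ} {c : ℝ} (hc : 0 < c)
    (hF : ∀ x, 0 < x → 0 ≤ F x) (hd : ∀ x, 0 < x → HasDerivAt F (F' x) x)
    (hG : ContinuousOn G (Ioi 0)) (hG0 : ∀ x, 0 < x → 0 ≤ G x)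
    (hle : ∀ x, 0 < x → c * G x ≤ -F' x) {β : ℝ} (hβ : 0 < β) :
    IntegrableOn G (Ioi β) ∧ ∫ b in Ioi β, G b ≤ F β / c := by
  have key : ∀ ε, β ≤ ε → ∫ b in β..ε, G b ≤ F β / c := by
    intro ε hε
    have h := intervalIntegral.integral_le_sub_of_hasDeriv_right_of_le (g := fun x => -F x)
      (g' := fun x => -F' x) (φ := fun b => c * G b) hε
      (fun x hx => (hd x (hβ.trans_le hx.1)).neg.continuousAt.continuousWithinAt)
      (fun x hx => (hd x (hβ.trans hx.1)).neg.hasDerivWithinAt)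
      ((continuousOn_const.mul (hG.mono fun x hx => hβ.trans_le hx.1)).integrableOn_Icc)
      (fun x hx => hle x (hβ.trans hx.1))
    rw [intervalIntegral.integral_const_mul] at h
    rw [le_div_iff₀ hc]
    linarith [hF ε (hβ.trans_le hε)]
  have hint : IntegrableOn G (Ioi β) := by
    refine integrableOn_Ioi_of_intervalIntegral_norm_bounded (F β / c) β (b := fun x : ℝ => x)
      (l := atTop) (fun i => ?_) tendsto_id ?_
    · exact ((hG.mono fun x hx => hβ.trans_le hx.1).integrableOn_Icc).mono_set Ioc_subset_Icc_self
    · filter_upwards [eventually_ge_atTop β] with x hx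
      refine le_trans (le_of_eq ?_) (key _ hx)
      rw [intervalIntegral.integral_of_le hx, intervalIntegral.integral_of_le hx]
      refine setIntegral_congr_fun measurableSet_Ioc fun y hy => ?_
      exact Real.norm_of_nonneg (hG0 y (hβ.trans hy.1))
  refine ⟨hint, ?_⟩
  refine le_of_tendsto (intervalIntegral_tendsto_integral_Ioi β hint tendsto_id) ?_
  filter_upwards [eventually_ge_atTop β] with x hx using key x hx

lemma MemCdelta.norm_le {δ : ℝ} (hδ : 0 < δ) {f : ℝ → ℂ} (hf : MemCdelta δ f 0) :
    (∀ β, 0 ≤ β → ‖f β‖ ≤ normC δ f 0) ∧ ∀ β, 0 < β → β ^ δ * ‖f β‖ ≤ normC δ f 0 := by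
  obtain ⟨hc, -, hb⟩ := hf
  have h2 : ∀ β, 0 < β → β ^ δ * ‖f β‖ ≤ hoel δ f 0 := fun β hβ => by
    simpa [hoel] using le_ciSup hb ⟨β, hβ⟩
  obtain ⟨M, hM⟩ := isCompact_Icc.exists_bound_of_continuousOn
    (hc.mono (Icc_subset_Ici_self : Icc (0 : ℝ) 1 ⊆ Ici 0))
  have hbs : BddAbove (Set.range fun β : Ici (0 : ℝ) => ‖f (β : ℝ)‖) := by
    refine ⟨max M (hoel δ f 0), ?_⟩
    rintro _ ⟨⟨β, hβ⟩, rfl⟩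
    rcases le_total β 1 with h | h
    · exact (hM β ⟨hβ, h⟩).trans (le_max_left _ _)
    · refine le_trans ?_ ((h2 β (by linarith)).trans (le_max_right _ _))
      exact le_mul_of_one_le_left (norm_nonneg _) (Real.one_le_rpow h hδ.le)
  have h1 : ∀ β, 0 ≤ β → ‖f β‖ ≤ supN f := fun β hβ => le_ciSup hbs ⟨β, hβ⟩
  have h1' : 0 ≤ supN f := (norm_nonneg _).trans (h1 0 le_rfl)
  have h2' : 0 ≤ hoel δ f 0 := le_trans (by positivity) (h2 1 one_pos)
  unfold normC
  exact ⟨fun β hβ => by linarith [h1 β hβ], fun β hβ => by linarith [h2 β hβ]⟩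

lemma memCdelta_of_bound {δ : ℝ} (hδ : 0 < δ) {F : ℝ → ℂ} {B : ℝ} (hF : ContinuousOn F (Ici 0))
    (h1 : ∀ β, 0 ≤ β → ‖F β‖ ≤ B) (h2 : ∀ β, 0 < β → β ^ δ * ‖F β‖ ≤ B) :
    MemCdelta δ F 0 ∧ normC δ F 0 ≤ 2 * B := by
  refine ⟨⟨hF, ?_, ⟨B, ?_⟩⟩, ?_⟩
  · refine squeeze_zero_norm' (a := fun β => B * β ^ (-δ)) ?_ ?_
    · filter_upwards [eventually_gt_atTop 0] with β hβ
      rw [Real.rpow_neg hβ.le, ← div_eq_mul_inv, le_div_iff₀ (by positivity), mul_comm]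
      exact h2 β hβ
    · simpa using (tendsto_rpow_neg_atTop hδ).const_mul B
  · rintro _ ⟨⟨β, hβ⟩, rfl⟩
    simpa using h2 β hβ
  · have hs : supN F ≤ B := ciSup_le fun β => h1 β β.2
    have hh : hoel δ F 0 ≤ B := by
      refine ciSup_le fun β => ?_
      simpa using h2 β β.2
    unfold normC
    linarith

section Coefficient

variable {μ : ℝ} {η : ℝ → ℝ} {n : ℤ}

lemma one_le_intCast_sq (hn : n ≠ 0) : (1 : ℝ) ≤ (n : ℝ) ^ 2 := by
  have : (1 : ℤ) ≤ n ^ 2 := by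
    have := sq_pos_of_ne_zero hn
    omega
  exact_mod_cast this

lemma sq_le_aFun_radicand (hμ : 1 < μ) (hη : ∀ β, 0 ≤ η β ∧ η β ≤ 1) (hn : n ≠ 0) (β : ℝ) :
    (μ - 1) ^ 2 ≤ (n : ℝ) ^ 2 * μ ^ 2 - (2 * μ - 1) * η β := by
  nlinarith [one_le_intCast_sq hn, (hη β).2, sq_nonneg μ,
    mul_nonneg (sub_nonneg.2 (one_le_intCast_sq hn)) (sq_nonneg μ)]

lemma le_aFun (hμ : 1 < μ) (hη : ∀ β, 0 ≤ η β ∧ η β ≤ 1) (hn : n ≠ 0) (β : ℝ) :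
    μ - 1 ≤ aFun μ η n β :=
  Real.le_sqrt_of_sq_le (sq_le_aFun_radicand hμ hη hn β)

lemma aFun_pos (hμ : 1 < μ) (hη : ∀ β, 0 ≤ η β ∧ η β ≤ 1) (hn : n ≠ 0) (β : ℝ) :
    0 < aFun μ η n β := (sub_pos.2 hμ).trans_le (le_aFun hμ hη hn β)

lemma continuous_aFun (hη : Continuous η) : Continuous (aFun μ η n) := by
  unfold aFun
  fun_prop

lemma aFun_le_of_abs_eq_one (hμ : 1 < μ) (hη : ∀ β, 0 ≤ η β ∧ η β ≤ 1) (hn : |n| = 1) (β : ℝ) :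
    aFun μ η n β ≤ μ := by
  have h : (n : ℝ) ^ 2 = 1 := by
    have : |(n : ℝ)| = 1 := by exact_mod_cast hn
    rw [← sq_abs, this, one_pow]
  refine Real.sqrt_le_iff.2 ⟨by linarith, ?_⟩
  rw [h]
  nlinarith [(hη β).1]

lemma aFun_ge_of_two_le_abs (hμ : 1 < μ) (hη : ∀ β, 0 ≤ η β ∧ η β ≤ 1) (hn : 2 ≤ |n|) (β : ℝ) :
    |(n : ℝ)| / 2 * √(4 * μ ^ 2 - 2 * μ + 1) ≤ aFun μ η n β := by
  have h : (2 : ℝ) ≤ |(n : ℝ)| := by exact_mod_cast hn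
  refine Real.le_sqrt_of_sq_le ?_
  rw [mul_pow, Real.sq_sqrt (by nlinarith), ← sq_abs (n : ℝ)]
  nlinarith [(hη β).2, mul_nonneg (by nlinarith : (0 : ℝ) ≤ |(n : ℝ)| ^ 2 - 4)
    (by linarith : (0 : ℝ) ≤ 2 * μ - 1)]

lemma hasDerivAt_WFun (hη : Continuous η) {β : ℝ} (hβ : 0 < β) :
    HasDerivAt (WFun μ η n) (WFun μ η n β * (aFun μ η n β / β)) β := by
  have hc : ContinuousOn (fun b => aFun μ η n b / b) (Ioi 0) :=
    (continuous_aFun hη).continuousOn.div continuousOn_id fun x hx => (ne_of_gt hx)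
  refine HasDerivAt.exp (intervalIntegral.integral_hasDerivAt_right ?_ ?_ ?_)
  · refine (hc.mono fun x hx => ?_).intervalIntegrable
    exact (lt_min one_pos hβ).trans_le hx.1
  · exact hc.stronglyMeasurableAtFilter isOpen_Ioi β hβ
  · exact hc.continuousAt (Ioi_mem_nhds hβ)

lemma WFun_pos (β : ℝ) : 0 < WFun μ η n β := Real.exp_pos _

lemma continuousOn_WFun (hη : Continuous η) : ContinuousOn (WFun μ η n) (Ioi 0) :=
  fun _ hx => (hasDerivAt_WFun hη hx).continuousAt.continuousWithinAt

lemma hasDerivAt_rpow_mul_WFun (hη : Continuous η) (s : ℝ) {β : ℝ} (hβ : 0 < β) :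
    HasDerivAt (fun b => b ^ (1 - 2 * μ - s) * WFun μ η n b)
      ((aFun μ η n β + 1 - 2 * μ - s) * (β ^ (-(2 * μ) - s) * WFun μ η n β)) β := by
  refine ((Real.hasDerivAt_rpow_const (Or.inl hβ.ne')).mul (hasDerivAt_WFun hη hβ)).congr_deriv ?_
  have h : β ^ (1 - 2 * μ - s) = β ^ (-(2 * μ) - s) * β := by
    rw [← Real.rpow_add_one hβ.ne']
    ring_nf
  rw [h, show 1 - 2 * μ - s - 1 = -(2 * μ) - s by ring]
  field_simp
  ring

lemma continuousOn_rpow_mul_WFun (hη : Continuous η) (p : ℝ) :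
    ContinuousOn (fun b => b ^ p * WFun μ η n b) (Ioi 0) :=
  (continuousOn_id.rpow_const fun _ hx => Or.inl (ne_of_gt hx)).mul (continuousOn_WFun hη)

/-- The part of the integrand of `Lminus` that does not depend on the outer variable. -/
noncomputable def kernelFun (μ : ℝ) (η : ℝ → ℝ) (n : ℤ) (f : ℝ → ℂ) (b : ℝ) : ℂ :=
  ((b ^ (-(2 * μ)) * WFun μ η n b : ℝ) : ℂ) * Complex.exp (-(Complex.I * n * b)) * f b

lemma kernel_eq (f : ℝ → ℂ) (β b : ℝ) :
    ((b ^ (-(2 * μ)) * WFun μ η n b : ℝ) : ℂ) *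
      Complex.exp (Complex.I * (n : ℂ) * ((β : ℂ) - (b : ℂ))) * f b =
    Complex.exp (Complex.I * n * β) * kernelFun μ η n f b := by
  rw [kernelFun, mul_sub, sub_eq_add_neg, Complex.exp_add]
  ring

lemma norm_exp_I_int_mul (β : ℝ) : ‖Complex.exp (Complex.I * n * β)‖ = 1 := by
  have := Complex.norm_exp_I_mul_ofReal (n * β)
  push_cast at this
  rwa [← mul_assoc] at this

lemma continuousOn_kernelFun (hη : Continuous η) {f : ℝ → ℂ} (hf : ContinuousOn f (Ici 0)) :
    ContinuousOn (kernelFun μ η n f) (Ioi 0) := by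
  refine ((Complex.continuous_ofReal.comp_continuousOn (continuousOn_rpow_mul_WFun hη _)).mul
    (Continuous.continuousOn (by fun_prop))).mul (hf.mono Ioi_subset_Ici_self)

lemma norm_kernelFun_le {f : ℝ → ℂ} {N s : ℝ} (hf : ∀ b, 0 < b → ‖f b‖ ≤ N * b ^ (-s)) {b : ℝ}
    (hb : 0 < b) : ‖kernelFun μ η n f b‖ ≤ N * (b ^ (-(2 * μ) - s) * WFun μ η n b) := by
  have hW := WFun_pos (μ := μ) (η := η) (n := n) b
  have he := norm_exp_I_int_mul (n := n) (-b)
  push_cast at he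
  rw [mul_neg] at he
  rw [kernelFun, norm_mul, norm_mul, he, Complex.norm_real, mul_one,
    Real.norm_of_nonneg (by positivity), sub_eq_add_neg (-(2 * μ)), Real.rpow_add hb]
  calc _ ≤ b ^ (-(2 * μ)) * WFun μ η n b * (N * b ^ (-s)) := by
        gcongr
        exact hf b hb
    _ = _ := by ring

lemma continuousOn_integral_Ioc {h : ℝ → ℂ} (hh : ∀ β, 0 < β → IntegrableOn h (Ioc 0 β)) :
    ContinuousOn (fun β => ∫ b in (0 : ℝ)..β, h b) (Ici 0) := by
  intro x hx
  have hx' : (0 : ℝ) ≤ x := hx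
  have hI : IntegrableOn h (uIcc 0 (x + 1)) := by
    rw [uIcc_of_le (by linarith), integrableOn_Icc_iff_integrableOn_Ioc]
    exact hh _ (by linarith)
  have := intervalIntegral.continuousOn_primitive_interval hI
  rw [uIcc_of_le (by linarith)] at this
  refine (this x ⟨hx', by linarith⟩).mono_of_mem_nhdsWithin ?_
  filter_upwards [self_mem_nhdsWithin, mem_nhdsWithin_of_mem_nhds (Iio_mem_nhds (lt_add_one x))]
    with y hy hy' using ⟨hy, le_of_lt hy'⟩

lemma continuousOn_integral_Ioi {h : ℝ → ℂ} (hh : ∀ β, 0 < β → IntegrableOn h (Ioi β)) :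
    ContinuousOn (fun β => ∫ b in Ioi β, h b) (Ioi 0) := by
  intro x hx
  have hx' : (0 : ℝ) < x := hx
  have h2 : 0 < x / 2 := by linarith
  have hI : IntegrableOn h (uIcc (x / 2) (x + 1)) := by
    rw [uIcc_of_le (by linarith), integrableOn_Icc_iff_integrableOn_Ioc]
    exact (hh _ h2).mono_set Ioc_subset_Ioi_self
  have := intervalIntegral.continuousOn_primitive_interval hI
  rw [uIcc_of_le (by linarith)] at this
  have hc := (this.continuousAt (Icc_mem_nhds (by linarith) (lt_add_one x))).const_sub
    (∫ b in Ioi (x / 2), h b)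
  refine (ContinuousAt.congr hc ?_).continuousWithinAt
  filter_upwards [Ioi_mem_nhds hx'] with y hy
  rw [sub_eq_iff_eq_add', intervalIntegral.integral_interval_add_Ioi (hh _ h2) (hh _ hy)]

/-- Pointwise bounds and continuity of `Lminus f` for `f` bounded by `N b ^ (-s)`. -/
lemma Lminus_spec (hη : Continuous η) {δ κ : ℝ} (hκ : 0 < κ) (hn : n ≠ 0)
    (h2 : 2 ≤ |n| → ∀ β, κ * |(n : ℝ)| ≤ aFun μ η n β + 1 - 2 * μ - δ)
    (h1 : |n| = 1 → ∀ β, κ * |(n : ℝ)| ≤ -(aFun μ η n β + 1 - 2 * μ))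
    {f : ℝ → ℂ} (hfc : ContinuousOn f (Ici 0)) {N s : ℝ} (hN : 0 ≤ N) (hs : 0 ≤ s) (hsδ : s ≤ δ)
    (hf : ∀ b, 0 < b → ‖f b‖ ≤ N * b ^ (-s)) :
    ContinuousOn (Lminus μ η n f) (Ioi 0) ∧
      ∀ β, 0 < β → ‖Lminus μ η n f β‖ ≤ N / (κ * |(n : ℝ)|) * β ^ (-s) := by
  have hn' : (0 : ℝ) < |(n : ℝ)| := abs_pos.2 (by exact_mod_cast hn)
  have hc : 0 < κ * |(n : ℝ)| := mul_pos hκ hn'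
  have hkc := continuousOn_kernelFun (μ := μ) (n := n) hη hfc
  have hG0 : ∀ x, 0 < x → 0 ≤ x ^ (-(2 * μ) - s) * WFun μ η n x := fun x hx => by
    have := WFun_pos (μ := μ) (η := η) (n := n) x
    positivity
  have hF : ∀ x, 0 < x → 0 ≤ x ^ (1 - 2 * μ - s) * WFun μ η n x := fun x hx => by
    have := WFun_pos (μ := μ) (η := η) (n := n) x
    positivity
  have hpre : ContinuousOn (fun β : ℝ => ((β ^ (2 * μ - 1) / WFun μ η n β : ℝ) : ℂ)) (Ioi 0) :=
    Complex.continuous_ofReal.comp_continuousOn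
      ((continuousOn_id.rpow_const fun _ hx => Or.inl (ne_of_gt hx)).div (continuousOn_WFun hη)
        fun x _ => (WFun_pos x).ne')
  have hexp : Continuous fun β : ℝ => Complex.exp (Complex.I * n * β) := by fun_prop
  have hfin : ∀ (β : ℝ), 0 < β → ∀ z : ℂ,
      ‖z‖ ≤ N * (β ^ (1 - 2 * μ - s) * WFun μ η n β / (κ * |(n : ℝ)|)) →
      ‖((β ^ (2 * μ - 1) / WFun μ η n β : ℝ) : ℂ) * (Complex.exp (Complex.I * n * β) * z)‖ ≤
        N / (κ * |(n : ℝ)|) * β ^ (-s) := by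
    intro β hβ z hz
    have hW := WFun_pos (μ := μ) (η := η) (n := n) β
    rw [norm_mul, norm_mul, norm_exp_I_int_mul, one_mul, Complex.norm_real,
      Real.norm_of_nonneg (by positivity)]
    have hp : β ^ (-s) = β ^ (2 * μ - 1) * β ^ (1 - 2 * μ - s) := by
      rw [← Real.rpow_add hβ]
      ring_nf
    calc _ ≤ β ^ (2 * μ - 1) / WFun μ η n β *
          (N * (β ^ (1 - 2 * μ - s) * WFun μ η n β / (κ * |(n : ℝ)|))) := by gcongr
      _ = _ := by
        rw [hp]
        field_simp
  by_cases hcase : 2 ≤ |n|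
  · have hA := fun (β : ℝ) (hβ : 0 < β) => integral_Ioc_le_of_deriv_ge hc hF
      (fun x hx => hasDerivAt_rpow_mul_WFun hη s hx) (continuousOn_rpow_mul_WFun hη _) hG0
      (fun x hx => mul_le_mul_of_nonneg_right (by linarith [h2 hcase x]) (hG0 x hx)) hβ
    have hLeq : Lminus μ η n f = fun β => -(((β ^ (2 * μ - 1) / WFun μ η n β : ℝ) : ℂ) *
        (Complex.exp (Complex.I * n * β) * ∫ b in (0 : ℝ)..β, kernelFun μ η n f b)) := by
      funext β
      simp only [Lminus, if_pos hcase, kernel_eq, intervalIntegral.integral_const_mul]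
    have hki : ∀ β, 0 < β → IntegrableOn (kernelFun μ η n f) (Ioc 0 β) := fun β hβ => by
      refine ((hA β hβ).1.const_mul N).mono'
        ((hkc.mono Ioc_subset_Ioi_self).aestronglyMeasurable measurableSet_Ioc) ?_
      exact ae_restrict_of_forall_mem measurableSet_Ioc fun x hx => norm_kernelFun_le hf hx.1
    rw [hLeq]
    refine ⟨(hpre.mul (hexp.continuousOn.mul
      ((continuousOn_integral_Ioc hki).mono Ioi_subset_Ici_self))).neg, fun β hβ => ?_⟩
    rw [norm_neg]
    refine hfin β hβ _ ?_
    refine (intervalIntegral.norm_integral_le_of_norm_le hβ.le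
      (Eventually.of_forall fun x hx => norm_kernelFun_le hf hx.1) ?_).trans ?_
    · exact (intervalIntegrable_iff_integrableOn_Ioc_of_le hβ.le).2 ((hA β hβ).1.const_mul N)
    · rw [intervalIntegral.integral_const_mul]
      exact mul_le_mul_of_nonneg_left (hA β hβ).2 hN
  · have hone : |n| = 1 := by
      have := abs_pos.2 hn
      omega
    have hA := fun (β : ℝ) (hβ : 0 < β) => integral_Ioi_le_of_deriv_le hc hF
      (fun x hx => hasDerivAt_rpow_mul_WFun hη s hx) (continuousOn_rpow_mul_WFun hη _) hG0
      (fun x hx => (mul_le_mul_of_nonneg_right (by linarith [h1 hone x]) (hG0 x hx)).trans_eq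
        (neg_mul _ _)) hβ
    have hLeq : Lminus μ η n f = fun β => ((β ^ (2 * μ - 1) / WFun μ η n β : ℝ) : ℂ) *
        (Complex.exp (Complex.I * n * β) * ∫ b in Ioi β, kernelFun μ η n f b) := by
      funext β
      simp only [Lminus, if_neg hcase, kernel_eq, MeasureTheory.integral_const_mul]
    have hki : ∀ β, 0 < β → IntegrableOn (kernelFun μ η n f) (Ioi β) := fun β hβ => by
      have hsub : Ioi β ⊆ Ioi 0 := Ioi_subset_Ioi hβ.le
      refine ((hA β hβ).1.const_mul N).mono'
        ((hkc.mono hsub).aestronglyMeasurable measurableSet_Ioi) ?_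
      exact ae_restrict_of_forall_mem measurableSet_Ioi fun x hx =>
        norm_kernelFun_le hf (hβ.trans hx)
    rw [hLeq]
    refine ⟨hpre.mul (hexp.continuousOn.mul (continuousOn_integral_Ioi hki)), fun β hβ => ?_⟩
    refine hfin β hβ _ ?_
    refine (MeasureTheory.norm_integral_le_of_norm_le ((hA β hβ).1.const_mul N)
      (ae_restrict_of_forall_mem measurableSet_Ioi fun x hx =>
        norm_kernelFun_le hf (hβ.trans hx))).trans ?_
    rw [MeasureTheory.integral_const_mul]
    exact mul_le_mul_of_nonneg_left (hA β hβ).2 hN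

end Coefficient

lemma deriv_eq_zero_of_eqOn_const {g : ℝ → ℝ} {U : Set ℝ} (hU : IsOpen U) {c : ℝ}
    (h : ∀ x ∈ U, g x = c) {x : ℝ} (hx : x ∈ U) : deriv g x = 0 := by
  have : g =ᶠ[𝓝 x] fun _ => c := eventually_of_mem (hU.mem_nhds hx) h
  rw [this.deriv_eq, deriv_const]

lemma exists_bound_of_eq_zero {g : ℝ → ℝ} (hg : Continuous g) (h : ∀ x, 2 < x → g x = 0) :
    ∃ M, 0 ≤ M ∧ ∀ x, 0 ≤ x → |g x| ≤ M := by
  obtain ⟨M, hM⟩ := isCompact_Icc.exists_bound_of_continuousOn (hg.continuousOn (s := Icc 0 2))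
  refine ⟨max M 0, le_max_right _ _, fun x hx => ?_⟩
  rcases le_or_gt x 2 with h2 | h2
  · exact (hM x ⟨hx, h2⟩).trans (le_max_left _ _)
  · simp [h x h2]

section Multiplier

variable {μ : ℝ} {η : ℝ → ℝ} {n : ℤ}

lemma hasDerivAt_aFun (hμ : 1 < μ) (hη : ∀ β, 0 ≤ η β ∧ η β ≤ 1) (hd : Differentiable ℝ η)
    (hn : n ≠ 0) (β : ℝ) :
    HasDerivAt (aFun μ η n) (-((2 * μ - 1) * deriv η β) / (2 * aFun μ η n β)) β := by
  refine HasDerivAt.sqrt (((hd β).hasDerivAt.const_mul (2 * μ - 1)).const_sub _) ?_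
  exact ((pow_pos (sub_pos.2 hμ) 2).trans_le (sq_le_aFun_radicand hμ hη hn β)).ne'

lemma mul_deriv_chiFun (hμ : 1 < μ) (hη : ∀ β, 0 ≤ η β ∧ η β ≤ 1) (hd : Differentiable ℝ η)
    (hg : Differentiable ℝ fun b => b * deriv η b) (hn : n ≠ 0) (β : ℝ) :
    β * deriv (chiFun μ η n) β = β * deriv η β -
      β * deriv (fun b => b * deriv η b) β / (2 * aFun μ η n β) -
      (2 * μ - 1) * (β * (β * deriv η β) * deriv η β) / (4 * aFun μ η n β ^ 3) := by
  have ha := (aFun_pos hμ hη hn β).ne'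
  have h : HasDerivAt (chiFun μ η n) _ β := (hd β).hasDerivAt.sub
    ((hg β).hasDerivAt.div ((hasDerivAt_aFun hμ hη hd hn β).const_mul 2)
      (mul_ne_zero two_ne_zero ha))
  rw [h.deriv]
  field_simp
  ring

lemma chiFun_spec (hμ : 1 < μ) (hη_smooth : ContDiff ℝ (⊤ : ℕ∞) η)
    (hη : ∀ β, 0 ≤ η β ∧ η β ≤ 1) (hη0 : ∀ β : ℝ, β ≤ 1 → η β = 0)
    (hη1 : ∀ β : ℝ, 2 ≤ β → η β = 1) :
    ∃ M, 0 ≤ M ∧ ∀ n : ℤ, n ≠ 0 →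
      (Continuous (chiFun μ η n) ∧ (∀ β < 1, chiFun μ η n β = 0) ∧
        (∀ β, 2 < β → chiFun μ η n β = 1) ∧ ∀ β, 0 ≤ β → |chiFun μ η n β| ≤ M) ∧
      (Continuous (fun β => β * deriv (chiFun μ η n) β)) ∧
        (∀ β < 1, β * deriv (chiFun μ η n) β = 0) ∧
        ∀ β, 0 ≤ β → |β * deriv (chiFun μ η n) β| ≤ M := by
  have hd : Differentiable ℝ η := hη_smooth.differentiable (by simp)
  have hη' : ContDiff ℝ (⊤ : ℕ∞) (deriv η) := (contDiff_infty_iff_deriv.1 hη_smooth).2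
  have hgs : ContDiff ℝ (⊤ : ℕ∞) fun b => b * deriv η b := contDiff_id.mul hη'
  have hg : Differentiable ℝ fun b => b * deriv η b := hgs.differentiable (by simp)
  have hg' : Continuous (deriv fun b => b * deriv η b) :=
    (contDiff_infty_iff_deriv.1 hgs).2.continuous
  have hη'c := hη'.continuous
  have l1 : ∀ β ∈ Iio (1 : ℝ), deriv η β = 0 := fun β hβ =>
    deriv_eq_zero_of_eqOn_const isOpen_Iio (fun x (hx : x < 1) => hη0 x hx.le) hβ
  have r1 : ∀ β ∈ Ioi (2 : ℝ), deriv η β = 0 := fun β hβ =>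
    deriv_eq_zero_of_eqOn_const isOpen_Ioi (fun x (hx : 2 < x) => hη1 x hx.le) hβ
  have l2 : ∀ β ∈ Iio (1 : ℝ), deriv (fun b => b * deriv η b) β = 0 := fun β hβ =>
    deriv_eq_zero_of_eqOn_const isOpen_Iio (c := 0) (fun x hx => by simp [l1 x hx]) hβ
  have r2 : ∀ β ∈ Ioi (2 : ℝ), deriv (fun b => b * deriv η b) β = 0 := fun β hβ =>
    deriv_eq_zero_of_eqOn_const isOpen_Ioi (c := 0) (fun x hx => by simp [r1 x hx]) hβ
  obtain ⟨M₁, hM₁, h₁⟩ := exists_bound_of_eq_zero hg.continuous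
    (fun x hx => by simp [r1 x hx])
  obtain ⟨M₂, hM₂, h₂⟩ := exists_bound_of_eq_zero (continuous_id.mul hg')
    (fun x hx => by simp [r2 x hx])
  obtain ⟨M₃, hM₃, h₃⟩ := exists_bound_of_eq_zero
    ((continuous_id.mul hg.continuous).mul hη'c) (fun x hx => by simp [r1 x hx])
  simp only [id, Pi.mul_apply] at h₂ h₃
  have hm : 0 < μ - 1 := sub_pos.2 hμ
  have hm2 : 0 < 2 * μ - 1 := by linarith
  have hP : 0 ≤ M₁ / (2 * (μ - 1)) := by positivity
  have hQ : 0 ≤ M₂ / (2 * (μ - 1)) := by positivity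
  have hR : 0 ≤ (2 * μ - 1) * M₃ / (4 * (μ - 1) ^ 3) := by positivity
  refine ⟨(1 + M₁ / (2 * (μ - 1))) +
    (M₁ + M₂ / (2 * (μ - 1)) + (2 * μ - 1) * M₃ / (4 * (μ - 1) ^ 3)), by positivity,
    fun n hn => ⟨⟨?_, ?_, ?_, ?_⟩, ?_, ?_, ?_⟩⟩
  all_goals have hac := continuous_aFun (μ := μ) (n := n) hd.continuous
  all_goals have hap := aFun_pos hμ hη hn
  · exact hd.continuous.sub (hg.continuous.div (continuous_const.mul hac)
      fun x => mul_ne_zero two_ne_zero (hap x).ne')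
  · intro β hβ
    simp [chiFun, l1 β hβ, hη0 β hβ.le]
  · intro β hβ
    simp [chiFun, r1 β hβ, hη1 β hβ.le]
  · intro β hβ
    have ha := le_aFun hμ hη hn β
    have e1 : |β * deriv η β / (2 * aFun μ η n β)| ≤ M₁ / (2 * (μ - 1)) := by
      rw [abs_div, abs_of_pos (mul_pos two_pos (hap β))]
      gcongr
      exact h₁ β hβ
    have e0 : |η β| ≤ 1 := abs_le.2 ⟨by linarith [(hη β).1], (hη β).2⟩
    have := abs_sub (η β) (β * deriv η β / (2 * aFun μ η n β))
    unfold chiFun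
    linarith
  all_goals simp only [mul_deriv_chiFun hμ hη hd hg hn]
  · refine (hg.continuous.sub ((continuous_id.mul hg').div (continuous_const.mul hac)
      fun x => mul_ne_zero two_ne_zero (hap x).ne')).sub ?_
    exact (continuous_const.mul ((continuous_id.mul hg.continuous).mul hη'c)).div
      (continuous_const.mul (hac.pow 3)) fun x => by
        have := hap x
        positivity
  · intro β hβ
    simp [l1 β hβ, l2 β hβ]
  · intro β hβ
    have ha := le_aFun hμ hη hn β
    have hap' := hap β
    have e1 := h₁ β hβ
    have e2 : |β * deriv (fun b => b * deriv η b) β / (2 * aFun μ η n β)| ≤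
        M₂ / (2 * (μ - 1)) := by
      rw [abs_div, abs_of_pos (mul_pos two_pos hap')]
      gcongr
      exact h₂ β hβ
    have e3 : |(2 * μ - 1) * (β * (β * deriv η β) * deriv η β) / (4 * aFun μ η n β ^ 3)| ≤
        (2 * μ - 1) * M₃ / (4 * (μ - 1) ^ 3) := by
      rw [abs_div, abs_mul, abs_of_pos hm2,
        abs_of_pos (by positivity : 0 < 4 * aFun μ η n β ^ 3)]
      gcongr
      exact h₃ β hβ
    have t1 := abs_sub (β * deriv η β) (β * deriv (fun b => b * deriv η b) β / (2 * aFun μ η n β))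
    have t2 := abs_sub (β * deriv η β -
      β * deriv (fun b => b * deriv η b) β / (2 * aFun μ η n β))
      ((2 * μ - 1) * (β * (β * deriv η β) * deriv η β) / (4 * aFun μ η n β ^ 3))
    linarith

end Multiplier

/-- A bounded multiplier vanishing near `0` maps functions with decay `β ^ (-δ)` that are continuous
away from `0` into the weighted space. -/
lemma memCdelta_mul {δ : ℝ} (hδ : 0 < δ) {m : ℝ → ℝ} {A : ℝ → ℂ} {M B : ℝ} (hM : 0 ≤ M)
    (hB : 0 ≤ B) (hm : Continuous m) (hm0 : ∀ β < 1, m β = 0) (hmM : ∀ β, 0 ≤ β → |m β| ≤ M)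
    (hA : ContinuousOn A (Ioi 0)) (hA1 : ∀ β, 0 < β → ‖A β‖ ≤ B)
    (hA2 : ∀ β, 0 < β → β ^ δ * ‖A β‖ ≤ B) :
    MemCdelta δ (fun β => (m β : ℂ) * A β) 0 ∧
      normC δ (fun β => (m β : ℂ) * A β) 0 ≤ 2 * (M * B) := by
  refine memCdelta_of_bound hδ (fun x hx => ?_) (fun β hβ => ?_) fun β hβ => ?_
  · refine ContinuousAt.continuousWithinAt ?_
    rcases lt_or_ge x 1 with h | h
    · refine (continuousAt_const (y := (0 : ℂ))).congr ?_
      filter_upwards [Iio_mem_nhds h] with y hy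
      simp [hm0 y hy]
    · exact (Complex.continuous_ofReal.comp hm).continuousAt.mul
        (hA.continuousAt (Ioi_mem_nhds (by linarith)))
  · rw [norm_mul, Complex.norm_real, Real.norm_eq_abs]
    rcases hβ.eq_or_lt with rfl | h
    · rw [hm0 0 one_pos, abs_zero, zero_mul]
      positivity
    · exact mul_le_mul (hmM β hβ) (hA1 β h) (norm_nonneg _) hM
  · rw [norm_mul, Complex.norm_real, Real.norm_eq_abs, mul_left_comm]
    exact mul_le_mul (hmM β hβ.le) (hA2 β hβ) (by positivity) hM

/-- Primitive of a function that is continuous away from `0` and bounded by `Q` and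
`Q β ^ (-δ)`. -/
lemma primitive_spec {δ Q : ℝ} (hδ1 : δ < 1) {g : ℝ → ℂ}
    (hg : ContinuousOn g (Ioi 0)) (h0 : ∀ β, 0 < β → ‖g β‖ ≤ Q)
    (h1 : ∀ β, 0 < β → ‖g β‖ ≤ Q * β ^ (-δ)) :
    ContinuousOn (fun β => ∫ b in (0 : ℝ)..β, g b) (Ici 0) ∧
      (∀ β, 0 ≤ β → ‖∫ b in (0 : ℝ)..β, g b‖ ≤ Q * β) ∧
      ∀ β, 0 < β → β ^ δ * ‖∫ b in (0 : ℝ)..β, g b‖ ≤ Q / (1 - δ) * β := by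
  refine ⟨continuousOn_integral_Ioc fun β hβ => ?_, fun β hβ => ?_, fun β hβ => ?_⟩
  · exact IntegrableOn.of_bound (C := Q) measure_Ioc_lt_top
      ((hg.mono Ioc_subset_Ioi_self).aestronglyMeasurable measurableSet_Ioc)
      (ae_restrict_of_forall_mem measurableSet_Ioc fun x hx => h0 x hx.1)
  · have := intervalIntegral.norm_integral_le_of_norm_le_const (a := 0) (b := β) (f := g) (C := Q)
      fun x hx => h0 x (by rw [uIoc_of_le hβ] at hx; exact hx.1)
    rwa [sub_zero, abs_of_nonneg hβ] at this
  · have h := intervalIntegral.norm_integral_le_of_norm_le (f := g) (μ := volume) hβ.le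
      (Eventually.of_forall fun x hx => h1 x hx.1)
      ((intervalIntegral.intervalIntegrable_rpow' (by linarith)).const_mul Q)
    rw [intervalIntegral.integral_const_mul, integral_rpow (Or.inl (by linarith)),
      Real.zero_rpow (by linarith), sub_zero] at h
    calc _ ≤ β ^ δ * (Q * (β ^ (-δ + 1) / (-δ + 1))) := by gcongr
      _ = Q / (1 - δ) * (β ^ δ * β ^ (-δ + 1)) := by
        rw [neg_add_eq_sub]
        ring
      _ = _ := by
        rw [← Real.rpow_add hβ]
        simp

/-- Uniform bounds for the perturbation operators `𝒦_{n,i}` on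
`𝒞^δ_0`: `‖𝒦_{n,1}f‖, ‖𝒦_{n,2}f‖ ≤ C|n|⁻¹‖f‖` and `‖𝒦_{n,3}f‖ ≤ C‖f‖`. -/
theorem stmt_16 (μ δ : ℝ) (hμ : 1 < μ)
    (hδ0 : 0 < δ)
    (hδ1 : δ < min (Real.sqrt (4 * μ ^ 2 - 2 * μ + 1) - 2 * μ + 1) 1)
    (η : ℝ → ℝ) (hη_smooth : ContDiff ℝ (⊤ : ℕ∞) η)
    (hη_range : ∀ β, 0 ≤ η β ∧ η β ≤ 1)
    (hη0 : ∀ β : ℝ, β ≤ 1 → η β = 0) (hη1 : ∀ β : ℝ, 2 ≤ β → η β = 1) :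
    ∃ C : ℝ, 0 < C ∧ ∀ n : ℤ, n ≠ 0 → ∀ f : ℝ → ℂ, MemCdelta δ f 0 →
      (MemCdelta δ (K1 μ η n f) 0 ∧ normC δ (K1 μ η n f) 0 ≤ C * |(n : ℝ)|⁻¹ * normC δ f 0) ∧
      (MemCdelta δ (K2 μ η n f) 0 ∧ normC δ (K2 μ η n f) 0 ≤ C * |(n : ℝ)|⁻¹ * normC δ f 0) ∧
      (MemCdelta δ (K3 μ η n f) 0 ∧ normC δ (K3 μ η n f) 0 ≤ C * normC δ f 0) := by
  obtain ⟨hδs, hδ1⟩ := lt_min_iff.1 hδ1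
  obtain ⟨M, hM, hchi⟩ := chiFun_spec hμ hη_smooth hη_range hη0 hη1
  have hηc := hη_smooth.continuous
  obtain ⟨κ, hκ, hκ1, hκ2⟩ : ∃ κ : ℝ, 0 < κ ∧ κ ≤ μ - 1 ∧
      2 * κ ≤ √(4 * μ ^ 2 - 2 * μ + 1) - 2 * μ + 1 - δ := by
    refine ⟨min (μ - 1) ((√(4 * μ ^ 2 - 2 * μ + 1) - 2 * μ + 1 - δ) / 2),
      lt_min (by linarith) (by linarith), min_le_left _ _, ?_⟩
    linarith [min_le_right (μ - 1) ((√(4 * μ ^ 2 - 2 * μ + 1) - 2 * μ + 1 - δ) / 2)]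
  have hδ' : 0 < 1 - δ := by linarith
  refine ⟨2 * M / (κ * (1 - δ)) + 8 * (1 + M) / κ, by positivity, fun n hn f hf => ?_⟩
  have hn' : (0 : ℝ) < |(n : ℝ)| := abs_pos.2 (by exact_mod_cast hn)
  obtain ⟨hf0, hfδ⟩ := hf.norm_le hδ0
  set N := normC δ f 0
  have hN : 0 ≤ N := (norm_nonneg _).trans (hf0 0 le_rfl)
  have hgap2 : 2 ≤ |n| → ∀ β, κ * |(n : ℝ)| ≤ aFun μ η n β + 1 - 2 * μ - δ := by
    intro h β
    have h2 : (2 : ℝ) ≤ |(n : ℝ)| := by exact_mod_cast h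
    nlinarith [aFun_ge_of_two_le_abs hμ hη_range h β]
  have hgap1 : |n| = 1 → ∀ β, κ * |(n : ℝ)| ≤ -(aFun μ η n β + 1 - 2 * μ) := by
    intro h β
    have h2 : |(n : ℝ)| = 1 := by exact_mod_cast h
    rw [h2]
    linarith [aFun_le_of_abs_eq_one hμ hη_range h β]
  obtain ⟨hLc, hL0⟩ := Lminus_spec (s := 0) hηc hκ hn hgap2 hgap1 hf.1 hN le_rfl hδ0.le
    (fun b hb => by simpa using hf0 b hb.le)
  obtain ⟨-, hLδ⟩ := Lminus_spec (s := δ) hηc hκ hn hgap2 hgap1 hf.1 hN hδ0.le le_rfl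
    (fun b hb => by
      rw [Real.rpow_neg hb.le, ← div_eq_mul_inv, le_div_iff₀ (by positivity), mul_comm]
      exact hfδ b hb)
  simp only [neg_zero, Real.rpow_zero, mul_one] at hL0
  set Q := N / (κ * |(n : ℝ)|) with hQdef
  have hQ : 0 ≤ Q := by positivity
  obtain ⟨hJc, hJ0, hJδ⟩ := primitive_spec hδ1 hLc hL0 hLδ
  have hAvg : EqOn (Avg (Lminus μ η n f))
      (fun β => ((β⁻¹ : ℝ) : ℂ) * ∫ b in (0 : ℝ)..β, Lminus μ η n f b) (Ioi 0) :=
    fun β hβ => if_neg (ne_of_gt hβ)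
  have hAc : ContinuousOn (Avg (Lminus μ η n f)) (Ioi 0) := by
    refine ContinuousOn.congr ?_ hAvg
    exact (Complex.continuous_ofReal.comp_continuousOn
      (continuousOn_inv₀.mono fun x hx => ne_of_gt hx)).mul (hJc.mono Ioi_subset_Ici_self)
  have hAn : ∀ β, 0 < β → ‖Avg (Lminus μ η n f) β‖ =
      ‖∫ b in (0 : ℝ)..β, Lminus μ η n f b‖ / β := fun β hβ => by
    rw [hAvg hβ, norm_mul, Complex.norm_real, Real.norm_of_nonneg (by positivity), div_eq_inv_mul]
  have hA0 : ∀ β, 0 < β → ‖Avg (Lminus μ η n f) β‖ ≤ Q / (1 - δ) := fun β hβ => by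
    rw [hAn β hβ, div_le_iff₀ hβ]
    refine (hJ0 β hβ.le).trans (mul_le_mul_of_nonneg_right ?_ hβ.le)
    exact le_div_self hQ hδ' (by linarith)
  have hAδ : ∀ β, 0 < β → β ^ δ * ‖Avg (Lminus μ η n f) β‖ ≤ Q / (1 - δ) := fun β hβ => by
    rw [hAn β hβ, ← mul_div_assoc, div_le_iff₀ hβ]
    exact hJδ β hβ
  obtain ⟨⟨hc, hc0, hc1, hcM⟩, hd, hd0, hdM⟩ := hchi n hn
  have hC : 2 * (M * (Q / (1 - δ))) ≤
      (2 * M / (κ * (1 - δ)) + 8 * (1 + M) / κ) * |(n : ℝ)|⁻¹ * N := by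
    have h1 : 2 * (M * (Q / (1 - δ))) = 2 * M / (κ * (1 - δ)) * |(n : ℝ)|⁻¹ * N := by
      rw [hQdef]
      field_simp
    rw [h1]
    gcongr
    exact le_add_of_nonneg_right (by positivity)
  have hB : 0 ≤ Q / (1 - δ) := by positivity
  have k1 := memCdelta_mul hδ0 hM hB hc hc0 hcM hAc hA0 hAδ
  have k2 := memCdelta_mul hδ0 hM hB hd hd0 hdM hAc hA0 hAδ
  have hT : ∀ β, 0 ≤ β → ‖K3 μ η n f β‖ ≤ (1 + M) * (N / κ * β) := fun β hβ => by
    have e : |1 - chiFun μ η n β| ≤ 1 + M := by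
      have := abs_sub 1 (chiFun μ η n β)
      rw [abs_one] at this
      linarith [hcM β hβ]
    have hnQ : |(n : ℝ)| * (Q * β) = N / κ * β := by
      rw [hQdef]
      field_simp
    rw [K3, Tn, norm_mul, norm_mul, norm_mul, Complex.norm_real, Complex.norm_I, one_mul,
      Complex.norm_intCast, Real.norm_eq_abs, ← hnQ]
    gcongr
    exact hJ0 β hβ
  have hT0 : ∀ β, 2 < β → K3 μ η n f β = 0 := fun β hβ => by simp [K3, hc1 β hβ]
  have hpos : 0 ≤ (1 + M) * (N / κ) := by positivity
  have k3 : MemCdelta δ (K3 μ η n f) 0 ∧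
      normC δ (K3 μ η n f) 0 ≤ 2 * (4 * ((1 + M) * (N / κ))) := by
    refine memCdelta_of_bound hδ0 ?_ (fun β hβ => ?_) fun β hβ => ?_
    · exact (Complex.continuous_ofReal.comp (continuous_const.sub hc)).continuousOn.mul
        (continuousOn_const.mul hJc)
    · rcases le_or_gt β 2 with h | h
      · nlinarith [hT β hβ, mul_le_mul_of_nonneg_left h hpos]
      · rw [hT0 β h, norm_zero]
        positivity
    · rcases le_or_gt β 2 with h | h
      · have h2 : β ^ δ ≤ 2 := by
          calc β ^ δ ≤ 2 ^ δ := Real.rpow_le_rpow hβ.le h hδ0.le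
            _ ≤ 2 ^ (1 : ℝ) := Real.rpow_le_rpow_of_exponent_le one_le_two hδ1.le
            _ = 2 := Real.rpow_one 2
        have h3 : ‖K3 μ η n f β‖ ≤ 2 * ((1 + M) * (N / κ)) := by
          nlinarith [hT β hβ.le, mul_le_mul_of_nonneg_left h hpos]
        calc _ ≤ 2 * (2 * ((1 + M) * (N / κ))) :=
              mul_le_mul h2 h3 (norm_nonneg _) two_pos.le
          _ = _ := by ring
      · rw [hT0 β h, norm_zero, mul_zero]
        positivity
  refine ⟨⟨k1.1, k1.2.trans hC⟩, ⟨k2.1, k2.2.trans hC⟩, k3.1, k3.2.trans ?_⟩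
  have h8 : 2 * (4 * ((1 + M) * (N / κ))) = 8 * (1 + M) / κ * N := by ring
  rw [h8]
  gcongr
  exact le_add_of_nonneg_left (by positivity)
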